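/- Let C be an (n,2)_q MDS code containing the zero word 0̄, with n < q + 1. Then the weight spectrum of C is W(C) = {n-1, n}. -/

import Mathlib

/-- `C ⊆ A^n` is an `(n,k)_q` MDS code: it has `q^k` codewords and its minimum
Hamming distance equals `n - k + 1`. -/
def IsMDS {A : Type*} [DecidableEq A] {n : ℕ} (q k : ℕ) (C : Finset (Fin n → A)) : Prop :=
  C.card = q ^ k ∧
    (∀ x ∈ C, ∀ y ∈ C, x ≠ y → n - k + 1 ≤ hammingDist x y) ∧
    (∃ x ∈ C, ∃ y ∈ C, x ≠ y ∧ hammingDist x y = n - k + 1)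

/-- The Hamming weight of a word `c : Fin n → A` relative to a distinguished
zero element `z` of the alphabet: the number of coordinates different from `z`. -/
def wt {A : Type*} [DecidableEq A] {n : ℕ} (z : A) (c : Fin n → A) : ℕ :=
  (Finset.univ.filter fun i => c i ≠ z).card

/-- Two codes are equivalent if one is obtained from the other by a permutation
`σ` of the coordinate positions together with a permutation `π i` of the alphabet
applied in each position `i`. -/
def CodeEquiv {A : Type*} [DecidableEq A] {n : ℕ} (C C' : Finset (Fin n → A)) : Prop :=
  ∃ (σ : Equiv.Perm (Fin n)) (π : Fin n → Equiv.Perm A),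
    C' = C.image fun c => fun i => π i (c (σ i))

section MDSTwo

variable {A : Type*} [DecidableEq A] {q n : ℕ}

/-- Words that agree in two distinct positions have distance at most `n - 2`. -/
theorem hammingDist_add_two_le {x y : Fin n → A} {i j : Fin n} (hij : i ≠ j)
    (hi : x i = y i) (hj : x j = y j) : hammingDist x y + 2 ≤ n := by
  have hsub : (Finset.univ.filter fun l => x l ≠ y l) ⊆ ({i, j} : Finset (Fin n))ᶜ := by
    intro l hl
    simp only [Finset.mem_filter, Finset.mem_univ, true_and] at hl
    simp only [Finset.mem_compl, Finset.mem_insert, Finset.mem_singleton, not_or]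
    exact ⟨fun h => hl (h ▸ hi), fun h => hl (h ▸ hj)⟩
  have hle := Finset.card_le_card hsub
  have hadd := Finset.card_add_card_compl ({i, j} : Finset (Fin n))
  rw [Finset.card_pair hij, Fintype.card_fin] at hadd
  have hdist : hammingDist x y = (Finset.univ.filter fun l => x l ≠ y l).card := rfl
  omega

/-- A codeword of an `(n,2)_q` MDS code is determined by any two of its coordinates. -/
theorem IsMDS.eq_of_agree {C : Finset (Fin n → A)} (hC : IsMDS q 2 C) {x y : Fin n → A}
    (hx : x ∈ C) (hy : y ∈ C) {i j : Fin n} (hij : i ≠ j) (hi : x i = y i) (hj : x j = y j) :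
    x = y := by
  by_contra hxy
  have hdist := hC.2.1 x hx y hy hxy
  have hle := hammingDist_add_two_le hij hi hj
  omega

/-- In an `(n,2)_q` MDS code any two coordinates can be prescribed. -/
theorem IsMDS.exists_mem_of_coords [Fintype A] {C : Finset (Fin n → A)} (hC : IsMDS q 2 C)
    (hA : Fintype.card A = q) {i j : Fin n} (hij : i ≠ j) (a b : A) :
    ∃ c ∈ C, c i = a ∧ c j = b := by
  have hinj : Set.InjOn (fun c : Fin n → A => (c i, c j)) C := fun x hx y hy h =>
    hC.eq_of_agree hx hy hij (congrArg Prod.fst h) (congrArg Prod.snd h)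
  have huniv : C.image (fun c => (c i, c j)) = Finset.univ := by
    rw [← Finset.card_eq_iff_eq_univ, Finset.card_image_of_injOn hinj, hC.1, Fintype.card_prod,
      hA, sq]
  have hmem : (a, b) ∈ C.image (fun c => (c i, c j)) := huniv ▸ Finset.mem_univ _
  obtain ⟨c, hc, h⟩ := Finset.mem_image.mp hmem
  exact ⟨c, hc, congrArg Prod.fst h, congrArg Prod.snd h⟩

/-- An `(n,2)_q` MDS code over an alphabet with `q ≥ 2` symbols has length at least two. -/
theorem IsMDS.two_le_length [Fintype A] {C : Finset (Fin n → A)} (hC : IsMDS q 2 C)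
    (hA : Fintype.card A = q) (hq : 2 ≤ q) : 2 ≤ n := by
  have hle := Finset.card_le_univ C
  rw [hC.1, Fintype.card_fun, Fintype.card_fin, hA] at hle
  exact (Nat.pow_le_pow_iff_right hq).mp hle

theorem wt_le_length (z : A) (c : Fin n → A) : wt z c ≤ n :=
  (Finset.card_le_univ _).trans_eq (Fintype.card_fin n)

theorem wt_lt_length {z : A} {c : Fin n → A} {i : Fin n} (hi : c i = z) : wt z c < n := by
  have hlt : (Finset.univ.filter fun l => c l ≠ z).card < (Finset.univ : Finset (Fin n)).card :=
    Finset.card_lt_card (Finset.filter_ssubset.mpr ⟨i, Finset.mem_univ i, not_not.mpr hi⟩)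
  simpa [wt] using hlt

theorem wt_eq_length {z : A} {c : Fin n → A} (hc : ∀ i, c i ≠ z) : wt z c = n := by
  simp [wt, hc]

/-- The words of an `(n,2)_q` MDS code with a given value at one position are more numerous than
the remaining positions when `n < q + 1`, so one of them avoids `z` at all the others. -/
theorem IsMDS.exists_mem_forall_ne [Fintype A] {C : Finset (Fin n → A)} (hC : IsMDS q 2 C)
    (hA : Fintype.card A = q) (hn : n < q + 1) {i j : Fin n} (hij : i ≠ j) {a z : A}
    (ha : a ≠ z) : ∃ c ∈ C, ∀ l, c l ≠ z := by
  by_contra! hzero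
  choose f hfC hfi hfj using hC.exists_mem_of_coords hA hij a
  choose g hg using fun b => hzero (f b) (hfC b)
  have hgi : ∀ b, g b ≠ i := fun b h => ha ((hfi b).symm.trans (h ▸ hg b))
  have hinj : Function.Injective g := fun b b' h => by
    have hf : f b = f b' := hC.eq_of_agree (hfC b) (hfC b') (hgi b).symm
      ((hfi b).trans (hfi b').symm) ((hg b).trans (h ▸ (hg b').symm))
    rw [← hfj b, ← hfj b', hf]
  have hlt := Fintype.card_lt_of_injective_of_notMem g hinj (b := i)
    (by rintro ⟨b, hb⟩; exact hgi b hb)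
  rw [hA, Fintype.card_fin] at hlt
  omega

end MDSTwo

/-- an `(n,2)_q` MDS code containing the zero word, with
`n < q + 1`, has weight spectrum `{n-1, n}`. -/
theorem stmt_12 {A : Type*} [Fintype A] [DecidableEq A] {q n : ℕ}
    (hq : 2 ≤ q) (hA : Fintype.card A = q) (z : A)
    (C : Finset (Fin n → A)) (hC : IsMDS q 2 C)
    (h0 : (fun _ : Fin n => z) ∈ C) (hn : n < q + 1) :
    {w : ℕ | ∃ c ∈ C, c ≠ (fun _ : Fin n => z) ∧ wt z c = w} = {n - 1, n} := by
  have hn2 := hC.two_le_length hA hq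
  have hlow : ∀ c ∈ C, c ≠ (fun _ => z) → n - 1 ≤ wt z c := fun c hc hne => by
    have hdist : n - 2 + 1 ≤ wt z c := hC.2.1 c hc _ h0 hne
    omega
  have : Nontrivial A := Fintype.one_lt_card_iff_nontrivial.mp (by omega)
  obtain ⟨a, ha⟩ := exists_ne z
  obtain ⟨i, j, hij⟩ : ∃ i j : Fin n, i ≠ j :=
    ⟨⟨0, by omega⟩, ⟨1, by omega⟩, by simp [Fin.ext_iff]⟩
  ext w
  simp only [Set.mem_ofPred_eq, Set.mem_insert_iff, Set.mem_singleton_iff]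
  constructor
  · rintro ⟨c, hc, hne, rfl⟩
    have hge := hlow c hc hne
    have hle := wt_le_length z c
    omega
  · rintro (rfl | rfl)
    · obtain ⟨c, hc, hci, hcj⟩ := hC.exists_mem_of_coords hA hij z a
      have hne : c ≠ fun _ => z := fun h => ha (hcj.symm.trans (congrFun h j))
      have hge := hlow c hc hne
      have hlt := wt_lt_length hci
      exact ⟨c, hc, hne, by omega⟩
    · obtain ⟨c, hc, hcz⟩ := hC.exists_mem_forall_ne hA hn hij ha
      exact ⟨c, hc, fun h => hcz i (congrFun h i), wt_eq_length hcz⟩
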